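/- arXiv:2401.14958 — 8 statements merged into one kernel-verified Lean document; each statement's English description precedes it below -/
import Mathlib

section
/- Let Q be an abundant acyclic quiver on n vertices with unique acyclic ordering v_1 ≺ v_2 ≺ ... ≺ v_n. Then for every j ≤ n, the mutation sequence w_j = [v_1, v_2, ..., v_j] is a source mutation sequence (each v_i is a source of the quiver obtained after mutating at v_1, ..., v_{i-1}), and the quiver Q^j = μ_{w_j}(Q) is abundant acyclic with unique acyclic ordering v_{j+1} ≺ ... ≺ v_n ≺ v_1 ≺ ... ≺ v_{j-1} ≺ v_j. -/
open Matrix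

section QuiverDefs

variable {V W : Type*}

/-- Mutation of an exchange matrix at the vertex `k`. -/
def mutB [DecidableEq V] (B : Matrix V V ℤ) (k : V) : Matrix V V ℤ :=
  Matrix.of fun i j =>
    if i = k ∨ j = k then -B i j else B i j + (B i k).sign * max (B i k * B k j) 0

/-- Mutation of the `C`-matrix of an extended exchange matrix `[B | C]` at the vertex `k`. -/
def mutC [DecidableEq V] (B : Matrix V V ℤ) (C : Matrix V W ℤ) (k : V) : Matrix V W ℤ :=
  Matrix.of fun i j =>
    if i = k then -C i j else C i j + (B i k).sign * max (B i k * C k j) 0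

/-- One mutation step on an extended exchange matrix `[B | C]`, regarded as a pair `(B, C)`. -/
def mutPair [DecidableEq V] (P : Matrix V V ℤ × Matrix V W ℤ) (k : V) :
    Matrix V V ℤ × Matrix V W ℤ :=
  (mutB P.1 k, mutC P.1 P.2 k)

/-- Iterated mutation of an extended exchange matrix along a list of mutable vertices. -/
def mutSeqPair [DecidableEq V] (P : Matrix V V ℤ × Matrix V W ℤ) (w : List V) :
    Matrix V V ℤ × Matrix V W ℤ :=
  w.foldl mutPair P

/-- Iterated mutation of an exchange matrix along a list of vertices. -/
def mutSeqB [DecidableEq V] (B : Matrix V V ℤ) (w : List V) : Matrix V V ℤ :=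
  w.foldl mutB B

/-- A quiver is abundant if there are at least two arrows between any two distinct vertices. -/
def QAbundant (B : Matrix V V ℤ) : Prop := ∀ i j, i ≠ j → 2 ≤ |B i j|

/-- There is a directed cycle of the quiver `B` all of whose vertices lie in `S`. -/
def HasCycleIn (B : Matrix V V ℤ) (S : Set V) : Prop :=
  ∃ (x : V) (l : List V), x ∈ S ∧ (∀ y ∈ l, y ∈ S) ∧
    List.Chain (fun i j => 0 < B i j) x (l ++ [x])

/-- A quiver is acyclic if it has no directed cycle. -/
def QAcyclic (B : Matrix V V ℤ) : Prop := ¬ HasCycleIn B Set.univ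

/-- The vertex `x` is a source: all arrows at `x` point away from `x`. -/
def QSource (B : Matrix V V ℤ) (x : V) : Prop := ∀ j, 0 ≤ B x j

/-- The vertex `x` is a sink: all arrows at `x` point into `x`. -/
def QSink (B : Matrix V V ℤ) (x : V) : Prop := ∀ j, B x j ≤ 0

/-- `B` is a fork with point of return `r`: it is abundant, not acyclic, the full subquiver
obtained by deleting `r` is acyclic, and for all `i` with `i → r` and `j` with `r → j` one has
`b_{ji} > b_{ir}` and `b_{ji} > b_{rj}`. -/
def QFork (B : Matrix V V ℤ) (r : V) : Prop :=
  QAbundant B ∧ ¬ QAcyclic B ∧ ¬ HasCycleIn B {x | x ≠ r} ∧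
    ∀ i j, 0 < B i r → 0 < B r j → B i r < B j i ∧ B r j < B j i

/-- The mutable vertex `i` is green: its `c`-vector is nonzero with all entries `≥ 0`. -/
def QGreen (C : Matrix V W ℤ) (i : V) : Prop := (∀ j, 0 ≤ C i j) ∧ C i ≠ 0

/-- The mutable vertex `i` is red: its `c`-vector is nonzero with all entries `≤ 0`. -/
def QRed (C : Matrix V W ℤ) (i : V) : Prop := (∀ j, C i j ≤ 0) ∧ C i ≠ 0

/-- The mutable vertex `i` is blue: its `c`-vector is zero. -/
def QBlue (C : Matrix V W ℤ) (i : V) : Prop := C i = 0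

/-- `i` has the same color (red/green/blue) with respect to `C` and to `C'`. -/
def SameColorQ (C C' : Matrix V W ℤ) (i : V) : Prop :=
  (QRed C i ↔ QRed C' i) ∧ (QGreen C i ↔ QGreen C' i) ∧ (QBlue C i ↔ QBlue C' i)

/-- The `c`-vectors of `i` and `j` have the same sign (`sgn(c_i) = sgn(c_j)`). -/
def SameSignQ (C : Matrix V W ℤ) (i j : V) : Prop :=
  (QGreen C i ∧ QGreen C j) ∨ (QRed C i ∧ QRed C j)

/-- The `c`-vectors of `i` and `j` have opposite signs (`sgn(c_i) = -sgn(c_j)`). -/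
def OppSignQ (C : Matrix V W ℤ) (i j : V) : Prop :=
  (QGreen C i ∧ QRed C j) ∨ (QRed C i ∧ QGreen C j)

/-- An ice quiver is uniformly sign-coherent if after every mutation sequence every mutable
vertex is red, green, or blue, and not every mutable vertex of the initial quiver is blue. -/
def USC [DecidableEq V] (P : Matrix V V ℤ × Matrix V W ℤ) : Prop :=
  (∀ (w : List V) (i : V),
      QRed (mutSeqPair P w).2 i ∨ QGreen (mutSeqPair P w).2 i ∨ QBlue (mutSeqPair P w).2 i) ∧
    ¬ ∀ i, QBlue P.2 i

/-- An ice quiver is strictly sign-coherent if after every mutation sequence every mutable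
vertex is red or green. -/
def SSC [DecidableEq V] (P : Matrix V V ℤ × Matrix V W ℤ) : Prop :=
  ∀ (w : List V) (i : V), QRed (mutSeqPair P w).2 i ∨ QGreen (mutSeqPair P w).2 i

/-- The four sign conditions at the distinguished vertex `r`:
(1) every mutable vertex is red or green;
(2) if every entry of `b_{rj}·c_j` is `≥ 0` for some `j ≠ r`, then `sgn(c_j) = sgn(c_r)` or
    `sgn(c_j)·c_j ≥ sgn(c_r)·c_r` entrywise (i.e. `|c_r| ≤ |c_j|` entrywise);
(3) if every entry of `b_{rj}·c_j` is `≤ 0` for some `j ≠ r`, then `sgn(c_j) = -sgn(c_r)`;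
(4) if every entry of `b_{ij}·c_j` is `≥ 0` for distinct `i, j` both `≠ r`,
    then `sgn(c_i) = sgn(c_j)`. -/
def FourConds (Bw : Matrix V V ℤ) (Cw : Matrix V W ℤ) (r : V) : Prop :=
  (∀ i, QRed Cw i ∨ QGreen Cw i) ∧
  (∀ j, j ≠ r → (∀ t, 0 ≤ Bw r j * Cw j t) →
    (SameSignQ Cw j r ∨ ∀ t, |Cw r t| ≤ |Cw j t|)) ∧
  (∀ j, j ≠ r → (∀ t, Bw r j * Cw j t ≤ 0) → OppSignQ Cw j r) ∧
  (∀ i j, i ≠ j → i ≠ r → j ≠ r → (∀ t, 0 ≤ Bw i j * Cw j t) → SameSignQ Cw i j)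

end QuiverDefs

theorem acyclic_of_rank {V : Type*} (M : Matrix V V ℤ) (f : V → ℕ)
    (hf : ∀ x y, 0 < M x y → f x < f y) : QAcyclic M := by
  rintro ⟨x, l, -, -, hc⟩
  have key : ∀ (l : List V) (z : V), List.Chain (fun i j => 0 < M i j) z (l ++ [x]) →
      f z < f x := by
    intro l
    induction l with
    | nil => intro z h; cases h with | cons_cons h _ => exact hf _ _ h
    | cons a l ih =>
      intro z h
      cases h with | cons_cons h h2 => exact (hf _ _ h).trans (ih a h2)
  exact lt_irrefl _ (key l x hc)

theorem mut_formula {n : ℕ} (B : Matrix (Fin n) (Fin n) ℤ)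
    (hskew : ∀ i j, B j i = -B i j) (v : Fin n → Fin n) (hinj : Function.Injective v)
    (hord : ∀ i j : Fin n, i < j → 0 < B (v i) (v j)) (j : ℕ) (hj : j ≤ n) :
    ∀ a b : Fin n, mutSeqB B ((List.ofFn v).take j) (v a) (v b) =
      if (a.1 < j ↔ b.1 < j) then B (v a) (v b) else -B (v a) (v b) := by
  induction j with
  | zero => intro a b; simp [mutSeqB]
  | succ j ih =>
    intro a b
    have ih := ih (by omega)
    have hl : j < (List.ofFn v).length := by simp; omega
    have hB0 : ∀ x, B x x = 0 := fun x => by have := hskew x x; omega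
    rw [List.take_succ_eq_append_getElem hl]
    simp only [mutSeqB, List.foldl_append, List.foldl_cons, List.foldl_nil]
    rw [show (List.ofFn v)[j] = v ⟨j, by omega⟩ by simp]
    simp only [mutSeqB] at ih
    have e1 := ih a ⟨j, by omega⟩
    have e2 := ih ⟨j, by omega⟩ b
    have e3 := ih a b
    simp only [mutB, Matrix.of_apply, hinj.eq_iff, e3]
    have s1 : List.foldl mutB B (List.take j (List.ofFn v)) (v a) (v ⟨j, by omega⟩) ≤ 0 := by
      rw [e1]
      rcases lt_trichotomy a.1 j with h | h | h
      · have := hord a ⟨j, by omega⟩ h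
        simp [h]; omega
      · have : a = ⟨j, by omega⟩ := Fin.ext h
        simp [this, hB0]
      · have := hord ⟨j, by omega⟩ a h
        have h2 := hskew (v ⟨j, by omega⟩) (v a)
        rw [if_pos (by simp; omega)]; omega
    have s2 : 0 ≤ List.foldl mutB B (List.take j (List.ofFn v)) (v ⟨j, by omega⟩) (v b) := by
      rw [e2]
      rcases lt_trichotomy b.1 j with h | h | h
      · have := hord b ⟨j, by omega⟩ h
        have h2 := hskew (v ⟨j, by omega⟩) (v b)
        simp [h]; omega
      · have : b = ⟨j, by omega⟩ := Fin.ext h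
        simp [this, hB0]
      · have := hord ⟨j, by omega⟩ b h
        rw [if_pos (by simp; omega)]; omega
    rw [max_eq_right (mul_nonpos_of_nonpos_of_nonneg s1 s2), mul_zero, add_zero]
    simp only [Fin.ext_iff]
    by_cases ha : a.1 = j
    · by_cases hb : b.1 = j
      · have : a = b := Fin.ext (by omega)
        subst this; simp [hB0]
      · have : (a.1 < j + 1 ↔ b.1 < j + 1) ↔ ¬ (a.1 < j ↔ b.1 < j) := by omega
        rw [if_pos (Or.inl ha)]
        by_cases hc : (a.1 < j ↔ b.1 < j)
        · rw [if_pos hc, if_neg (fun h => this.mp h hc)]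
        · rw [if_neg hc, if_pos (this.mpr hc), neg_neg]
    · by_cases hb : b.1 = j
      · have : (a.1 < j + 1 ↔ b.1 < j + 1) ↔ ¬ (a.1 < j ↔ b.1 < j) := by omega
        rw [if_pos (Or.inr hb)]
        by_cases hc : (a.1 < j ↔ b.1 < j)
        · rw [if_pos hc, if_neg (fun h => this.mp h hc)]
        · rw [if_neg hc, if_pos (this.mpr hc), neg_neg]
      · have : (a.1 < j + 1 ↔ b.1 < j + 1) ↔ (a.1 < j ↔ b.1 < j) := by omega
        simp only [this, ha, hb, or_self, if_false]

/-- Lemma `lem-source-acyclic-mutation-order`. -/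
theorem source_mutation_cycles_acyclic_ordering {n : ℕ}
    (B : Matrix (Fin n) (Fin n) ℤ)
    (hskew : ∀ i j, B j i = -B i j)
    (habund : QAbundant B) (hacyc : QAcyclic B)
    (v : Fin n → Fin n) (hsurj : Function.Surjective v)
    (hord : ∀ i j : Fin n, i < j → 0 < B (v i) (v j))
    (j : ℕ) (hj : j ≤ n) :
    (∀ i : Fin n, (i : ℕ) < j →
      QSource (mutSeqB B ((List.ofFn v).take i.1)) (v i)) ∧
    QAbundant (mutSeqB B ((List.ofFn v).take j)) ∧
    QAcyclic (mutSeqB B ((List.ofFn v).take j)) ∧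
    List.Pairwise (fun a b => 0 < mutSeqB B ((List.ofFn v).take j) a b)
      ((List.ofFn v).drop j ++ (List.ofFn v).take j) := by
  have hinj : Function.Injective v := Finite.injective_iff_surjective.mpr hsurj
  have hB0 : ∀ x, B x x = 0 := fun x => by have := hskew x x; omega
  have hle : ∀ a b : Fin n, 0 < B (v a) (v b) → a < b := by
    intro a b h
    by_contra hc
    rcases lt_or_eq_of_le (not_lt.mp hc) with h1 | h1
    · have := hord _ _ h1
      have := hskew (v a) (v b)
      omega
    · subst h1; rw [hB0] at h; omega
  have F := mut_formula B hskew v hinj hord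
  refine ⟨?_, ?_, ?_, ?_⟩
  · intro i hi y
    obtain ⟨b, rfl⟩ := hsurj y
    rw [F i.1 (by omega) i b]
    rcases lt_trichotomy b i with h | h | h
    · have := hord b i h
      have h2 := hskew (v i) (v b)
      have h3 : b.1 < i.1 := h
      rw [if_neg (by omega)]; omega
    · subst h; simp [hB0]
    · have := hord i b h
      have h3 : i.1 < b.1 := h
      rw [if_pos (by omega)]; omega
  · intro x y hxy
    have := habund x y hxy
    obtain ⟨a, rfl⟩ := hsurj x
    obtain ⟨b, rfl⟩ := hsurj y
    rw [F j hj]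
    split_ifs
    · exact this
    · rwa [abs_neg]
  · let e := Equiv.ofBijective v ⟨hinj, hsurj⟩
    refine acyclic_of_rank _ (fun x => if (e.symm x).1 < j then (e.symm x).1 + n else (e.symm x).1) ?_
    intro x y h
    obtain ⟨a, rfl⟩ := hsurj x
    obtain ⟨b, rfl⟩ := hsurj y
    have he : ∀ a, e.symm (v a) = a := fun a => e.symm_apply_apply a
    rw [F j hj] at h
    simp only [he]
    have hs := hskew (v a) (v b)
    split_ifs at h with h1
    · have : a.1 < b.1 := hle _ _ h
      split_ifs <;> omega
    · have : b.1 < a.1 := hle b a (by omega)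
      split_ifs <;> omega
  · rw [List.pairwise_append]
    refine ⟨?_, ?_, ?_⟩
    · rw [List.pairwise_iff_getElem]
      intro p q hp hq hpq
      simp only [List.length_drop, List.length_ofFn] at hp hq
      simp only [List.getElem_drop, List.getElem_ofFn]
      rw [F j hj, if_pos (by simp)]
      exact hord _ _ (by simp [Fin.lt_def]; omega)
    · rw [List.pairwise_iff_getElem]
      intro p q hp hq hpq
      simp only [List.length_take, List.length_ofFn] at hp hq
      simp only [List.getElem_take, List.getElem_ofFn]
      rw [F j hj, if_pos (by simp; omega)]
      exact hord _ _ hpq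
    · intro x hx y hy
      obtain ⟨p, hp, rfl⟩ := List.mem_iff_getElem.mp hx
      obtain ⟨q, hq, rfl⟩ := List.mem_iff_getElem.mp hy
      simp only [List.length_take, List.length_drop, List.length_ofFn] at hp hq
      simp only [List.getElem_take, List.getElem_drop, List.getElem_ofFn]
      rw [F j hj, if_neg (by simp; omega)]
      have h := hord ⟨q, by omega⟩ ⟨j + p, by omega⟩ (by simp [Fin.lt_def]; omega)
      have := hskew (v ⟨q, by omega⟩) (v ⟨j + p, by omega⟩)
      omega
end

section
/- Let F be a fork on n vertices with point of return r, and let v_1 ≺ v_2 ≺ ... ≺ v_{n-1} be the unique acyclic ordering of the full subquiver F \ {r}. Fix a vertex v_j and let F' = μ_{v_j}(F). If f_{r v_j} > 0 (i.e., r → v_j in F), then the full subquiver F' \ {v_j} is abundant acyclic with unique acyclic ordering r ≺ v_1 ≺ ... ≺ v_{j-1} ≺ v_{j+1} ≺ ... ≺ v_{n-1}. If f_{v_j r} > 0 (i.e., v_j → r in F), then F' \ {v_j} is abundant acyclic with unique acyclic ordering v_1 ≺ ... ≺ v_{j-1} ≺ v_{j+1} ≺ ... ≺ v_{n-1} ≺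 r. -/
open Matrix

lemma mutB_eval {n : ℕ} (B : Matrix (Fin n) (Fin n) ℤ) (k a b : Fin n) (ha : a ≠ k) (hb : b ≠ k) :
    mutB B k a b = B a b + (if 0 < B a k ∧ 0 < B k b then B a k * B k b
      else if B a k < 0 ∧ B k b < 0 then -(B a k * B k b) else 0) := by
  have h : mutB B k a b = B a b + (B a k).sign * max (B a k * B k b) 0 := by
    simp [mutB, ha, hb]
  rw [h]
  congr 1
  rcases lt_trichotomy (B a k) 0 with h1 | h1 | h1
  · rw [Int.sign_eq_neg_one_of_neg h1]
    by_cases h2 : B k b < 0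
    · rw [if_neg (by omega), if_pos ⟨h1, h2⟩, max_eq_left (by nlinarith)]; ring
    · rw [if_neg (by omega), if_neg (by omega), max_eq_right (by nlinarith)]; ring
  · simp [h1]
  · rw [Int.sign_eq_one_of_pos h1]
    by_cases h2 : 0 < B k b
    · rw [if_pos ⟨h1, h2⟩, max_eq_left (by nlinarith)]; ring
    · rw [if_neg (by omega), if_neg (by omega), max_eq_right (by nlinarith)]; ring

lemma mutB_skew {n : ℕ} (B : Matrix (Fin n) (Fin n) ℤ) (hskew : ∀ i j, B j i = -B i j)
    (k a b : Fin n) (ha : a ≠ k) (hb : b ≠ k) : mutB B k b a = - mutB B k a b := by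
  rw [mutB_eval B k a b ha hb, mutB_eval B k b a hb ha, hskew a b, hskew k b, hskew a k]
  split_ifs <;> first | omega | ring

/-- Pairwise relation on the list of values of `v` with index `j` removed. -/
lemma pairwise_eraseIdx_ofFn {α : Type*} {m : ℕ} (v : Fin m → α) (j : Fin m) (R : α → α → Prop)
    (h : ∀ i k, i ≠ j → k ≠ j → i < k → R (v i) (v k)) :
    List.Pairwise R ((List.ofFn v).eraseIdx j.1) := by
  have hl : ((List.ofFn v).eraseIdx j.1).length = m - 1 := by
    rw [List.length_eraseIdx_of_lt (by simp)]; simp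
  rw [List.pairwise_iff_getElem]
  intro a b ha hb hab
  rw [List.getElem_eraseIdx, List.getElem_eraseIdx]
  rw [hl] at ha hb
  split_ifs <;> simp only [List.getElem_ofFn] <;> apply h <;>
    simp only [ne_eq, Fin.ext_iff, Fin.lt_def] <;> omega

lemma mem_eraseIdx_ofFn {α : Type*} {m : ℕ} (v : Fin m → α) (j : Fin m) (x : α)
    (h : x ∈ (List.ofFn v).eraseIdx j.1) : ∃ i, i ≠ j ∧ x = v i := by
  rw [List.mem_eraseIdx_iff_getElem] at h
  obtain ⟨i, hi, hne, hx⟩ := h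
  simp only [List.getElem_ofFn] at hx
  exact ⟨_, by simpa [Fin.ext_iff] using hne, hx.symm⟩

/-- Lemma `lem-fork-mutate-order`. -/
theorem fork_mutate_acyclic_ordering {n : ℕ}
    (B : Matrix (Fin n) (Fin n) ℤ)
    (hskew : ∀ i j, B j i = -B i j)
    (r : Fin n) (hfork : QFork B r)
    (v : Fin (n - 1) → Fin n) (hner : ∀ i, v i ≠ r)
    (henum : ∀ u, u ≠ r → ∃ i, u = v i)
    (hord : ∀ i j : Fin (n - 1), i < j → 0 < B (v i) (v j))
    (j : Fin (n - 1)) :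
    (∀ a b, a ≠ v j → b ≠ v j → a ≠ b → 2 ≤ |mutB B (v j) a b|) ∧
    (0 < B r (v j) →
      List.Pairwise (fun a b => 0 < mutB B (v j) a b)
        (r :: (List.ofFn v).eraseIdx j.1)) ∧
    (0 < B (v j) r →
      List.Pairwise (fun a b => 0 < mutB B (v j) a b)
        ((List.ofFn v).eraseIdx j.1 ++ [r])) := by
  obtain ⟨hab, -, -, hf⟩ := hfork
  have hpos : ∀ a b, 0 < B a b → 2 ≤ B a b := by
    intro a b h
    have hne : a ≠ b := by
      rintro rfl
      have := hskew a a
      omega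
    have := hab a b hne
    rwa [abs_of_pos h] at this
  have hvne : ∀ i k, i ≠ k → v i ≠ v k := by
    intro i k hik he
    have h0 := hskew (v k) (v k)
    rcases lt_or_gt_of_ne hik with h | h <;> have := hord _ _ h <;> rw [he] at this <;> omega
  have hrv : r ≠ v j := (hner j).symm
  have K1 : ∀ i k, i ≠ j → k ≠ j → i < k → 2 ≤ mutB B (v j) (v i) (v k) := by
    intro i k hi hk hik
    rw [mutB_eval B _ _ _ (hvne i j hi) (hvne k j hk)]
    have h1 := hpos _ _ (hord i k hik)
    split_ifs with h2 h3
    · nlinarith [h2.1, h2.2]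
    · exfalso
      rcases lt_or_gt_of_ne hi with h | h
      · have := hord _ _ h
        omega
      · have := hord _ _ (h.trans hik)
        omega
    · omega
  have K2 : 0 < B r (v j) → ∀ i, i ≠ j → 2 ≤ mutB B (v j) r (v i) := by
    intro hr i hi
    rw [mutB_eval B _ _ _ hrv (hvne i j hi)]
    have hr2 := hpos _ _ hr
    rcases lt_or_ge 0 (B r (v i)) with h | h
    · have h1 := hpos _ _ h
      split_ifs with h2 h3
      · nlinarith [h2.1, h2.2]
      · omega
      · omega
    · have h1 : 0 < B (v i) r := by
        have h3 := hab r (v i) (hner i).symm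
        rw [abs_of_nonpos h] at h3
        have := hskew r (v i)
        omega
      have h2 := (hf _ _ h1 hr).1
      have h3 := hskew r (v i)
      rw [if_pos ⟨hr, h1.trans h2⟩]
      have h4 := hpos _ _ (h1.trans h2)
      nlinarith
  have K3 : 0 < B (v j) r → ∀ i, i ≠ j → 2 ≤ mutB B (v j) (v i) r := by
    intro hr i hi
    rw [mutB_eval B _ _ _ (hvne i j hi) hrv]
    have hr2 := hpos _ _ hr
    rcases lt_or_ge 0 (B (v i) r) with h | h
    · have h1 := hpos _ _ h
      split_ifs with h2 h3
      · nlinarith [h2.1, h2.2]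
      · omega
      · omega
    · have h1 : 0 < B r (v i) := by
        have h3 := hab (v i) r (hner i)
        rw [abs_of_nonpos h] at h3
        have := hskew r (v i)
        omega
      have h2 := (hf _ _ hr h1).2
      have h3 := hskew r (v i)
      rw [if_pos ⟨h1.trans h2, hr⟩]
      have h4 := hpos _ _ (h1.trans h2)
      nlinarith
  have Kr : ∀ i, i ≠ j → 2 ≤ |mutB B (v j) r (v i)| := by
    intro i hi
    rcases lt_or_ge 0 (B r (v j)) with h | h
    · exact (K2 h i hi).trans (le_abs_self _)
    · have h3 := hab r (v j) hrv
      rw [abs_of_nonpos h] at h3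
      have h4 := hskew r (v j)
      have := K3 (by omega) i hi
      rw [mutB_skew B hskew _ _ _ hrv (hvne i j hi)] at this
      exact this.trans (neg_le_abs _)
  refine ⟨?_, ?_, ?_⟩
  · intro a b ha hb hne
    by_cases har : a = r
    · subst har
      obtain ⟨i, rfl⟩ := henum b hne.symm
      exact Kr i (fun h => hb (by rw [h]))
    · obtain ⟨i, rfl⟩ := henum a har
      have hi : i ≠ j := fun h => ha (by rw [h])
      by_cases hbr : b = r
      · subst hbr
        rw [mutB_skew B hskew _ _ _ hb ha, abs_neg]
        exact Kr i hi
      · obtain ⟨k, rfl⟩ := henum b hbr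
        have hk : k ≠ j := fun h => hb (by rw [h])
        have hik : i ≠ k := fun h => hne (by rw [h])
        rcases lt_or_gt_of_ne hik with h | h
        · exact (K1 i k hi hk h).trans (le_abs_self _)
        · rw [mutB_skew B hskew _ _ _ hb ha, abs_neg]
          exact (K1 k i hk hi h).trans (le_abs_self _)
  · intro hr
    rw [List.pairwise_cons]
    refine ⟨?_, ?_⟩
    · intro x hx
      obtain ⟨i, hi, rfl⟩ := mem_eraseIdx_ofFn v j x hx
      have := K2 hr i hi
      omega
    · apply pairwise_eraseIdx_ofFn
      intro i k hi hk hik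
      have := K1 i k hi hk hik
      omega
  · intro hr
    rw [List.pairwise_append]
    refine ⟨?_, List.pairwise_singleton _ _, ?_⟩
    · apply pairwise_eraseIdx_ofFn
      intro i k hi hk hik
      have := K1 i k hi hk hik
      omega
    · intro x hx y hy
      rw [List.mem_singleton] at hy
      subst hy
      obtain ⟨i, hi, rfl⟩ := mem_eraseIdx_ofFn v j x hx
      have := K3 hr i hi
      omega
end

section
/- Let F be a fork on n vertices with point of return r, and let v_1 ≺ v_2 ≺ ... ≺ v_{n-1} be the unique acyclic ordering of the full subquiver F \ {r}. For j ≤ n-1, let w_j = [v_1, v_2, ..., v_j] and F^j = μ_{w_j}(F). Then the full subquiver F^j \ {v_j} is abundant acyclic with unique acyclic ordering r ≺ v_{j+1} ≺ ... ≺ v_{n-1} ≺ v_1 ≺ ... ≺ v_{j-1}, and the full subquiver F^j \ {r} is abundant acyclic with unique acyclic ordering v_{j+1} ≺ ... ≺ v_{n-1} ≺ v_1 ≺ ... ≺ v_{j-1} ≺ v_j. -/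
open Matrix

lemma chain_out {V : Type*} (R : V → V → Prop) (w : V) (l : List V) :
    ∀ x, List.IsChain R (x :: (l ++ [w])) → ∀ y ∈ x :: l, ∃ z, R y z := by
  induction l with
  | nil =>
    intro x h y hy
    simp at h hy
    exact ⟨w, hy ▸ h⟩
  | cons a l ih =>
    intro x h y hy
    rw [List.cons_append, List.isChain_cons_cons] at h
    rcases List.mem_cons.1 hy with rfl | hy
    · exact ⟨a, h.1⟩
    · exact ih a h.2 y hy

lemma fork_out {V : Type*} (B : Matrix V V ℤ) (r : V) (hfork : QFork B r) :
    ∃ z, 0 < B r z := by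
  by_contra hno
  obtain ⟨-, hc, hc', -⟩ := hfork
  apply hc
  rintro ⟨x, l, -, -, hl⟩
  have key := chain_out _ x l x hl
  have hne : ∀ y ∈ x :: l, y ≠ r := by
    rintro y hy rfl
    exact hno (key y hy)
  exact hc' ⟨x, l, hne x (by simp), fun y hy => hne y (by simp [hy]), hl⟩

lemma mutB_skew_s2 {V : Type*} [DecidableEq V] (M : Matrix V V ℤ)
    (h : ∀ i j, M j i = -M i j) (k : V) : ∀ i j, mutB M k j i = - mutB M k i j := by
  intro i j
  simp only [mutB, Matrix.of_apply]
  by_cases hi : i = k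
  · simp [hi, h k j]
  by_cases hj : j = k
  · simp [hj, h k i]
  simp only [hi, hj, or_self, if_false]
  rw [h i j, h k j, h i k]
  have e : -M k j * -M i k = M i k * M k j := by ring
  rw [e]
  rcases le_or_gt (M i k * M k j) 0 with hp | hp
  · simp [max_eq_right hp]
  · have : (M k j).sign = (M i k).sign := by
      rcases pos_and_pos_or_neg_and_neg_of_mul_pos hp with ⟨h1, h2⟩ | ⟨h1, h2⟩
      · rw [Int.sign_eq_one_of_pos h1, Int.sign_eq_one_of_pos h2]
      · rw [Int.sign_eq_neg_one_of_neg h1, Int.sign_eq_neg_one_of_neg h2]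
    rw [Int.sign_neg, this]; ring

/-- The invariant after mutating at the vertices `v 0, ..., v j`. -/
structure ForkInv {V : Type*} {N : ℕ} (v : Fin N → V) (r : V) (M : Matrix V V ℤ)
    (j : Fin N) : Prop where
  skew : ∀ a b, M b a = -M a b
  same : ∀ a b : Fin N, a < b → (b ≤ j ∨ j < a) → 2 ≤ M (v a) (v b)
  opp : ∀ a b : Fin N, a ≤ j → j < b → 2 ≤ M (v b) (v a)
  ret : 2 ≤ M (v j) r
  big : ∀ k, k ≠ j → M (v j) r < M r (v k)

lemma fork_step {V : Type*} [DecidableEq V] {N : ℕ} (v : Fin N → V) (r : V)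
    (hv : Function.Injective v) (hner : ∀ i, v i ≠ r) (M : Matrix V V ℤ)
    (hs : ∀ a b, M b a = -M a b) (c : Fin N)
    (hsrc : ∀ a, a ≠ c → 2 ≤ M (v c) (v a)) (hr : 2 ≤ M r (v c))
    (hlt : ∀ a b : Fin N, a < b → (b < c ∨ c < a) → 2 ≤ M (v a) (v b))
    (hopp : ∀ a b : Fin N, a < c → c < b → 2 ≤ M (v b) (v a))
    (hbig : ∀ k, k ≠ c → M r (v c) < M r (v k) + M r (v c) * M (v c) (v k)) :
    ForkInv v r (mutB M (v c)) c := by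
  have hin : ∀ a b, a ≠ c → b ≠ c → mutB M (v c) (v a) (v b) = M (v a) (v b) := by
    intro a b ha hb
    have h1 := hsrc a ha
    have h2 := hsrc b hb
    have h3 := hs (v c) (v a)
    have h4 : M (v a) (v c) * M (v c) (v b) ≤ 0 := by
      rw [h3]; nlinarith
    simp [mutB, hv.ne ha, hv.ne hb, max_eq_right h4]
  have hR : ∀ a, a ≠ c → mutB M (v c) r (v a) = M r (v a) + M r (v c) * M (v c) (v a) := by
    intro a ha
    have h1 := hsrc a ha
    have h4 : 0 ≤ M r (v c) * M (v c) (v a) := by positivity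
    simp [mutB, hv.ne ha, (hner c).symm, max_eq_left h4,
      Int.sign_eq_one_of_pos (show 0 < M r (v c) by omega)]
  have hc1 : ∀ x, mutB M (v c) (v c) x = - M (v c) x := by intro x; simp [mutB]
  have hc2 : ∀ x, mutB M (v c) x (v c) = - M x (v c) := by intro x; simp [mutB]
  refine ⟨mutB_skew_s2 M hs _, ?_, ?_, ?_, ?_⟩
  · intro a b hab h
    have hac : a ≠ c := by
      rintro rfl
      rcases h with h | h
      · exact absurd hab (not_lt.2 h)
      · exact lt_irrefl _ h
    by_cases hb : b = c
    · subst hb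
      rw [hc2, hs (v b) (v a), neg_neg]
      exact hsrc a hac
    · rw [hin a b hac hb]
      exact hlt a b hab (h.imp (fun h => lt_of_le_of_ne h hb) id)
  · intro a b ha hb
    by_cases hac : a = c
    · subst hac
      rw [hc2, hs (v a) (v b), neg_neg]
      exact hsrc b hb.ne'
    · rw [hin b a hb.ne' hac]
      exact hopp a b (lt_of_le_of_ne ha hac) hb
  · rw [hc1, hs r (v c), neg_neg]; exact hr
  · intro k hk
    rw [hc1, hs r (v c), neg_neg, hR k hk]
    exact hbig k hk

lemma fork_inv {V : Type*} [DecidableEq V] {N : ℕ} (B : Matrix V V ℤ)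
    (hskew : ∀ i j, B j i = -B i j) (r : V) (hfork : QFork B r)
    (v : Fin N → V) (hner : ∀ i, v i ≠ r) (hv : Function.Injective v)
    (henum : ∀ u, u ≠ r → ∃ i, u = v i)
    (hord : ∀ i j : Fin N, i < j → 0 < B (v i) (v j)) (j : ℕ) (hj : j < N) :
    ForkInv v r (mutSeqB B ((List.ofFn v).take (j + 1))) ⟨j, hj⟩ := by
  have hab : ∀ a b, 0 < B a b → 2 ≤ B a b := by
    intro a b h
    have hne : a ≠ b := by
      rintro rfl
      have := hskew a a
      omega
    have := hfork.1 a b hne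
    rwa [abs_of_pos h] at this
  induction j with
  | zero =>
    have e : mutSeqB B ((List.ofFn v).take (0 + 1)) = mutB B (v ⟨0, hj⟩) := by
      rw [List.take_succ_eq_append_getElem (by simpa using hj)]
      simp [mutSeqB]
    rw [e]
    have hpos : ∀ a : Fin N, a ≠ ⟨0, hj⟩ → 0 < B (v ⟨0, hj⟩) (v a) := by
      intro a ha
      apply hord
      have : a.1 ≠ 0 := fun h => ha (Fin.ext h)
      exact Fin.lt_def.2 (by simp; omega)
    have hr0 : 0 < B r (v ⟨0, hj⟩) := by
      by_contra hcon
      have h2 := hfork.1 r (v ⟨0, hj⟩) (hner _).symm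
      have h1 : 0 < B (v ⟨0, hj⟩) r := by
        rw [hskew r]
        rcases abs_cases (B r (v ⟨0, hj⟩)) with h | h <;> omega
      obtain ⟨z, hz⟩ := fork_out B r hfork
      have hzr : z ≠ r := by
        rintro rfl
        have := hskew z z
        omega
      obtain ⟨k, rfl⟩ := henum z hzr
      have h3 := (hfork.2.2.2 _ _ h1 hz).1
      have h4 := hpos k (by rintro rfl; omega)
      have h5 := hskew (v k) (v ⟨0, hj⟩)
      omega
    have hr2 := hab _ _ hr0
    apply fork_step v r hv hner B hskew _ (fun a ha => hab _ _ (hpos a ha)) hr2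
    · intro a b h _
      exact hab _ _ (hord a b h)
    · intro a b h _
      exact absurd (Fin.lt_def.1 h) (by simp)
    · intro k hk
      have h0 := hab _ _ (hpos k hk)
      rcases lt_or_ge 0 (B r (v k)) with h | h
      · nlinarith
      · have h2 := hfork.1 r (v k) (hner _).symm
        have h1 : 0 < B (v k) r := by
          rw [hskew r]
          rcases abs_cases (B r (v k)) with h | h <;> omega
        have h3 := (hfork.2.2.2 _ _ h1 hr0).1
        have h4 := hskew r (v k)
        nlinarith [mul_nonneg (sub_nonneg.2 hr2) (sub_nonneg.2 h0)]
  | succ j ih =>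
    have hj0 : j < N := by omega
    have I := ih hj0
    have e : mutSeqB B ((List.ofFn v).take (j + 1 + 1)) =
        mutB (mutSeqB B ((List.ofFn v).take (j + 1))) (v ⟨j + 1, hj⟩) := by
      rw [List.take_succ_eq_append_getElem (i := j + 1) (by simpa using hj)]
      simp [mutSeqB]
    rw [e]
    set M := mutSeqB B ((List.ofFn v).take (j + 1))
    have hne : (⟨j + 1, hj⟩ : Fin N) ≠ ⟨j, by omega⟩ := by simp
    have hret := I.ret
    have hc := I.big _ hne
    have hsrc : ∀ a : Fin N, a ≠ ⟨j + 1, hj⟩ → 2 ≤ M (v ⟨j + 1, hj⟩) (v a) := by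
      intro a ha
      have ha' : a.1 ≠ j + 1 := fun h => ha (Fin.ext h)
      rcases lt_or_ge j a.1 with h | h
      · apply I.same
        · exact Fin.lt_def.2 (by simp; omega)
        · right; exact Fin.lt_def.2 (by simp)
      · apply I.opp
        · exact Fin.le_def.2 (by simpa using h)
        · exact Fin.lt_def.2 (by simp)
    apply fork_step v r hv hner M I.skew _ hsrc (by omega)
    · intro a b h h'
      apply I.same a b h
      simp only [Fin.lt_def, Fin.le_def] at h' ⊢
      omega
    · intro a b h h'
      simp only [Fin.lt_def] at h h'
      apply I.opp
      · simp only [Fin.le_def]; omega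
      · simp only [Fin.lt_def]; omega
    · intro k hk
      have h0 := hsrc k hk
      by_cases hkj : k = ⟨j, hj0⟩
      · subst hkj
        have := I.skew (v ⟨j, hj0⟩) r
        nlinarith
      · have := I.big k hkj
        nlinarith

/-- Lemma `lem-source-fork-mutation-order`. -/
theorem source_fork_mutation_acyclic_ordering {n : ℕ}
    (B : Matrix (Fin n) (Fin n) ℤ)
    (hskew : ∀ i j, B j i = -B i j)
    (r : Fin n) (hfork : QFork B r)
    (v : Fin (n - 1) → Fin n) (hner : ∀ i, v i ≠ r)
    (henum : ∀ u, u ≠ r → ∃ i, u = v i)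
    (hord : ∀ i j : Fin (n - 1), i < j → 0 < B (v i) (v j))
    (j : Fin (n - 1)) :
    (∀ a b, a ≠ v j → b ≠ v j → a ≠ b →
      2 ≤ |mutSeqB B ((List.ofFn v).take (j.1 + 1)) a b|) ∧
    List.Pairwise (fun a b => 0 < mutSeqB B ((List.ofFn v).take (j.1 + 1)) a b)
      (r :: ((List.ofFn v).drop (j.1 + 1) ++ (List.ofFn v).take j.1)) ∧
    (∀ a b, a ≠ r → b ≠ r → a ≠ b →
      2 ≤ |mutSeqB B ((List.ofFn v).take (j.1 + 1)) a b|) ∧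
    List.Pairwise (fun a b => 0 < mutSeqB B ((List.ofFn v).take (j.1 + 1)) a b)
      ((List.ofFn v).drop (j.1 + 1) ++ (List.ofFn v).take (j.1 + 1)) := by
  have hv : Function.Injective v := by
    intro a b hab
    by_contra hne
    rcases lt_or_gt_of_ne hne with h | h
    · have h1 := hord _ _ h
      rw [hab] at h1
      have := hskew (v b) (v b)
      omega
    · have h1 := hord _ _ h
      rw [hab] at h1
      have := hskew (v b) (v b)
      omega
  have I := fork_inv B hskew r hfork v hner hv henum hord j.1 j.2
  set M := mutSeqB B ((List.ofFn v).take (j.1 + 1))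
  have hj : (⟨j.1, j.2⟩ : Fin (n - 1)) = j := rfl
  rw [hj] at I
  have hret := I.ret
  have hvlt : ∀ a b : Fin (n - 1), a < b → 2 ≤ |M (v a) (v b)| := by
    intro a b h
    by_cases h1 : b ≤ j ∨ j < a
    · exact le_trans (I.same a b h h1) (le_abs_self _)
    · push Not at h1
      have := I.opp a b h1.2 h1.1
      rw [I.skew (v b) (v a), abs_neg]
      exact le_trans this (le_abs_self _)
  have hvv : ∀ a b, a ≠ r → b ≠ r → a ≠ b → 2 ≤ |M a b| := by
    intro a b ha hb hne
    obtain ⟨x, rfl⟩ := henum a ha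
    obtain ⟨y, rfl⟩ := henum b hb
    rcases lt_or_gt_of_ne (fun h : x = y => hne (congrArg v h)) with h | h
    · exact hvlt x y h
    · rw [I.skew (v y) (v x), abs_neg]
      exact hvlt y x h
  have hrk : ∀ a, a ≠ r → a ≠ v j → 2 ≤ |M r a| := by
    intro a ha haj
    obtain ⟨x, rfl⟩ := henum a ha
    have := I.big x (fun h => haj (congrArg v h))
    exact le_trans (by omega) (le_abs_self _)
  have hdrop : List.Pairwise (fun a b => 0 < M a b) ((List.ofFn v).drop (j.1 + 1)) := by
    rw [List.pairwise_iff_getElem]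
    intro a b ha hb hab
    simp only [List.getElem_drop, List.getElem_ofFn]
    have := I.same ⟨j.1 + 1 + a, by simp at ha; omega⟩ ⟨j.1 + 1 + b, by simp at hb; omega⟩
      (Fin.lt_def.2 (by simpa using hab)) (Or.inr (Fin.lt_def.2 (by simp; omega)))
    omega
  have htake : List.Pairwise (fun a b => 0 < M a b) ((List.ofFn v).take (j.1 + 1)) := by
    rw [List.pairwise_iff_getElem]
    intro a b ha hb hab
    simp only [List.getElem_take, List.getElem_ofFn]
    simp at ha hb
    have := I.same ⟨a, by omega⟩ ⟨b, by omega⟩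
      (Fin.lt_def.2 (by simpa using hab)) (Or.inl (Fin.le_def.2 (by simp; omega)))
    omega
  have hmd : ∀ a ∈ (List.ofFn v).drop (j.1 + 1), ∃ i, j < i ∧ a = v i := by
    intro a ha
    obtain ⟨k, hk, rfl⟩ := List.getElem_of_mem ha
    simp at hk
    exact ⟨⟨j.1 + 1 + k, by omega⟩, Fin.lt_def.2 (by simp; omega), by simp⟩
  have hmt : ∀ m, m ≤ j.1 + 1 → ∀ a ∈ (List.ofFn v).take m, ∃ i : Fin (n - 1),
      i.1 < m ∧ a = v i := by
    intro m hm a ha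
    obtain ⟨k, hk, rfl⟩ := List.getElem_of_mem ha
    simp at hk
    exact ⟨⟨k, by omega⟩, by simp; omega, by simp⟩
  have hcross : ∀ a ∈ (List.ofFn v).drop (j.1 + 1), ∀ b ∈ (List.ofFn v).take (j.1 + 1),
      0 < M a b := by
    intro a ha b hb
    obtain ⟨x, hx, rfl⟩ := hmd a ha
    obtain ⟨y, hy, rfl⟩ := hmt _ le_rfl b hb
    have := I.opp y x (Fin.le_def.2 (by omega)) hx
    omega
  have hsub : ((List.ofFn v).take j.1).Sublist ((List.ofFn v).take (j.1 + 1)) :=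
    (List.take_prefix_take_left (Nat.le_succ _)).sublist
  refine ⟨?_, ?_, hvv, ?_⟩
  · intro a b ha hb hne
    by_cases har : a = r
    · subst har
      exact hrk b hne.symm hb
    by_cases hbr : b = r
    · subst hbr
      rw [I.skew b a, abs_neg]
      exact hrk a hne ha
    exact hvv a b har hbr hne
  · rw [List.pairwise_cons]
    refine ⟨?_, ?_⟩
    · intro a ha
      have : ∃ i, i ≠ j ∧ a = v i := by
        rcases List.mem_append.1 ha with h | h
        · obtain ⟨i, hi, rfl⟩ := hmd a h
          exact ⟨i, hi.ne', rfl⟩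
        · obtain ⟨i, hi, rfl⟩ := hmt _ (Nat.le_succ _) a h
          exact ⟨i, fun h => by subst h; omega, rfl⟩
      obtain ⟨i, hi, rfl⟩ := this
      have := I.big i hi
      omega
    · rw [List.pairwise_append]
      exact ⟨hdrop, htake.sublist hsub, fun a ha b hb => hcross a ha b (hsub.subset hb)⟩
  · rw [List.pairwise_append]
    exact ⟨hdrop, htake, hcross⟩
end

section
/- Let Q = [B | C] be a uniformly sign-coherent ice quiver whose mutable subquiver B is abundant acyclic with unique acyclic ordering v_1 ≺ v_2 ≺ ... ≺ v_n. Fix a mutable vertex v_j and let Q' = μ_{v_j}(Q). Then: (1) if v_j is blue in Q, every mutable vertex has the same color (red/green/blue) in Q' as in Q; (2) if v_j is green in Q, then every vertex v_i with v_j ≺ v_i has the same color in Q' as in Q, and v_j is red in Q'; (3) if v_j is red in Q, then every vertex v_i with v_i ≺ v_j has the same color in Q' as in Q, and v_j is green in Q'. -/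
open Matrix

/-- If all corrections vanish, the c-vector at `u ≠ k` is unchanged by mutation at `k`. -/
theorem mutC_row_eq {V W : Type*} [DecidableEq V] (B : Matrix V V ℤ) (C : Matrix V W ℤ)
    (k u : V) (huk : u ≠ k) (h : ∀ t, B u k * C k t ≤ 0) : mutC B C k u = C u := by
  funext t
  simp [mutC, huk, max_eq_right (h t)]

theorem mutC_row_self {V W : Type*} [DecidableEq V] (B : Matrix V V ℤ) (C : Matrix V W ℤ)
    (k : V) : mutC B C k k = -C k := by
  funext t
  simp [mutC]

theorem sameColor_of_row_eq {V W : Type*} (C C' : Matrix V W ℤ) (u : V) (h : C' u = C u) :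
    SameColorQ C C' u := by
  simp [SameColorQ, QRed, QGreen, QBlue, h]

/-- Lemma `lem-color-abundant acyclic`. -/
theorem color_abundant_acyclic {n m : ℕ}
    (B : Matrix (Fin n) (Fin n) ℤ) (C : Matrix (Fin n) (Fin m) ℤ)
    (hskew : ∀ i j, B j i = -B i j)
    (husc : USC (B, C))
    (habund : QAbundant B) (hacyc : QAcyclic B)
    (v : Fin n → Fin n) (hsurj : Function.Surjective v)
    (hord : ∀ i j : Fin n, i < j → 0 < B (v i) (v j))
    (j : Fin n) :
    (QBlue C (v j) → ∀ u : Fin n, SameColorQ C (mutPair (B, C) (v j)).2 u) ∧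
    (QGreen C (v j) →
      (∀ i : Fin n, j < i → SameColorQ C (mutPair (B, C) (v j)).2 (v i)) ∧
      QRed (mutPair (B, C) (v j)).2 (v j)) ∧
    (QRed C (v j) →
      (∀ i : Fin n, i < j → SameColorQ C (mutPair (B, C) (v j)).2 (v i)) ∧
      QGreen (mutPair (B, C) (v j)).2 (v j)) := by
  have hne : ∀ a b : Fin n, a < b → v a ≠ v b := by
    intro a b hab he
    have h1 := hord a b hab
    have h2 := hskew (v a) (v b)
    rw [he] at h1 h2
    omega
  refine ⟨fun hb u => ?_, fun hg => ⟨fun i hi => ?_, ?_⟩, fun hr => ⟨fun i hi => ?_, ?_⟩⟩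
  · apply sameColor_of_row_eq
    have hb' : C (v j) = 0 := hb
    by_cases hu : u = v j
    · subst hu
      exact (mutC_row_self B C (v j)).trans (by simp [hb'])
    · exact mutC_row_eq B C (v j) u hu (fun t => by simp [hb'])
  · apply sameColor_of_row_eq
    refine mutC_row_eq B C (v j) (v i) (hne j i hi).symm (fun t => ?_)
    have h1 := hord j i hi
    have h2 := hskew (v j) (v i)
    exact mul_nonpos_of_nonpos_of_nonneg (by omega) (hg.1 t)
  · have h := mutC_row_self B C (v j)
    refine ⟨fun t => ?_, ?_⟩
    · have := hg.1 t
      simp [mutPair, h, this]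
    · simpa [mutPair, h] using hg.2
  · apply sameColor_of_row_eq
    refine mutC_row_eq B C (v j) (v i) (hne i j hi) (fun t => ?_)
    exact mul_nonpos_of_nonneg_of_nonpos (hord i j hi).le (hr.1 t)
  · have h := mutC_row_self B C (v j)
    refine ⟨fun t => ?_, ?_⟩
    · have := hr.1 t
      simp [mutPair, h, this]
    · simpa [mutPair, h] using hr.2
end

section
/- Let Q = [B | C] be a uniformly sign-coherent ice quiver whose mutable subquiver is a fork F = (f_{ij}) with point of return r, and let v_1 ≺ ... ≺ v_{n-1} be the unique acyclic ordering of F \ {r}. Fix a mutable vertex v_j ≠ r and let F' = μ_{v_j}(Q). Then: (1) if v_j is blue in Q, every mutable vertex has the same color in F' as in Q; (2) if v_j is green in Q, then every vertex v_i with v_j ≺ v_i has the same color in F' as in Q, the color of r is unchanged if f_{v_j r} > 0, and v_j is red in F'; (3) if v_j is red in Q, then every vertex v_i with v_i ≺ v_j has the same color in F' as in Q, the color of r is unchanged if f_{r v_j} > 0, and v_j is green in F'. -/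
open Matrix

/-- Corollary `cor-color-fork`. -/
theorem color_fork {n m : ℕ}
    (B : Matrix (Fin n) (Fin n) ℤ) (C : Matrix (Fin n) (Fin m) ℤ)
    (hskew : ∀ i j, B j i = -B i j)
    (husc : USC (B, C))
    (r : Fin n) (hfork : QFork B r)
    (v : Fin (n - 1) → Fin n) (hner : ∀ i, v i ≠ r)
    (henum : ∀ u, u ≠ r → ∃ i, u = v i)
    (hord : ∀ i j : Fin (n - 1), i < j → 0 < B (v i) (v j))
    (j : Fin (n - 1)) :
    (QBlue C (v j) → ∀ u : Fin n, SameColorQ C (mutPair (B, C) (v j)).2 u) ∧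
    (QGreen C (v j) →
      (∀ i : Fin (n - 1), j < i → SameColorQ C (mutPair (B, C) (v j)).2 (v i)) ∧
      (0 < B (v j) r → SameColorQ C (mutPair (B, C) (v j)).2 r) ∧
      QRed (mutPair (B, C) (v j)).2 (v j)) ∧
    (QRed C (v j) →
      (∀ i : Fin (n - 1), i < j → SameColorQ C (mutPair (B, C) (v j)).2 (v i)) ∧
      (0 < B r (v j) → SameColorQ C (mutPair (B, C) (v j)).2 r) ∧
      QGreen (mutPair (B, C) (v j)).2 (v j)) := by
  have key : ∀ u : Fin n, u ≠ v j → (∀ t, B u (v j) * C (v j) t ≤ 0) →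
      SameColorQ C (mutPair (B, C) (v j)).2 u := by
    intro u hu h
    have hrow : (mutPair (B, C) (v j)).2 u = C u := by
      funext t
      simp [mutPair, mutC, hu, max_eq_right (h t)]
    simp [SameColorQ, QRed, QGreen, QBlue, hrow]
  have hself : (mutPair (B, C) (v j)).2 (v j) = -C (v j) := by
    funext t
    simp [mutPair, mutC]
  have hne : ∀ u, 0 < B u (v j) ∨ 0 < B (v j) u → u ≠ v j := by
    rintro u h rfl
    have := hskew (v j) (v j)
    omega
  refine ⟨fun hb u => ?_, fun hg => ⟨fun i hi => ?_, fun hr => ?_, ?_⟩,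
    fun hg => ⟨fun i hi => ?_, fun hr => ?_, ?_⟩⟩
  · have hb' : C (v j) = 0 := hb
    by_cases hu : u = v j
    · subst hu
      simp [SameColorQ, QRed, QGreen, QBlue, hself, hb']
    · exact key u hu fun t => by simp [hb']
  · have h := hord j i hi
    refine key _ (hne _ (Or.inr h)) fun t => mul_nonpos_of_nonpos_of_nonneg ?_ (hg.1 t)
    have := hskew (v j) (v i)
    omega
  · refine key _ (hne _ (Or.inr hr)) fun t => mul_nonpos_of_nonpos_of_nonneg ?_ (hg.1 t)
    have := hskew (v j) r
    omega
  · refine ⟨fun t => ?_, ?_⟩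
    · have := hg.1 t
      simp [hself, this]
    · rw [hself]
      exact neg_ne_zero.mpr hg.2
  · have h := hord i j hi
    exact key _ (hne _ (Or.inl h)) fun t => mul_nonpos_of_nonneg_of_nonpos h.le (hg.1 t)
  · exact key _ (hne _ (Or.inl hr)) fun t => mul_nonpos_of_nonneg_of_nonpos hr.le (hg.1 t)
  · refine ⟨fun t => ?_, ?_⟩
    · have := hg.1 t
      simp [hself, this]
    · rw [hself]
      exact neg_ne_zero.mpr hg.2
end

section
/- Let Q = [B | C] be a uniformly sign-coherent ice quiver whose mutable subquiver is abundant acyclic with unique acyclic ordering v_1 ≺ v_2 ≺ ... ≺ v_n. Fix j ≤ n and let Q^j = μ_{[v_1, v_2, ..., v_j]}(Q). If v_j is red in Q, then the vertices v_1, v_2, ..., v_{j-1} are all red in Q^j and v_j is green in Q^j. -/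
open Matrix

theorem take_ofFn_succ_aux {n : ℕ} (v : Fin n → Fin n) (k : Fin n) :
    (List.ofFn v).take (k.1 + 1) = (List.ofFn v).take k.1 ++ [v k] := by
  rw [List.take_succ_eq_append_getElem (by simp)]
  simp

theorem mutSeqPair_succ_aux {n m : ℕ} (P : Matrix (Fin n) (Fin n) ℤ × Matrix (Fin n) (Fin m) ℤ)
    (v : Fin n → Fin n) (k : Fin n) :
    mutSeqPair P ((List.ofFn v).take (k.1 + 1)) =
      mutPair (mutSeqPair P ((List.ofFn v).take k.1)) (v k) := by
  rw [take_ofFn_succ_aux]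
  simp [mutSeqPair, List.foldl_append]

/-- Sign pattern of the exchange matrix along source mutations. -/
theorem B_inv_aux {n m : ℕ}
    (B : Matrix (Fin n) (Fin n) ℤ) (C : Matrix (Fin n) (Fin m) ℤ)
    (hskew : ∀ i j, B j i = -B i j)
    (v : Fin n → Fin n) (hinj : Function.Injective v)
    (hord : ∀ i j : Fin n, i < j → 0 < B (v i) (v j)) (k : ℕ) (hk : k ≤ n) :
    ∀ a b : Fin n, (mutSeqPair (B, C) ((List.ofFn v).take k)).1 (v a) (v b) =
      if (a.1 < k ↔ b.1 < k) then B (v a) (v b) else - B (v a) (v b) := by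
  induction k with
  | zero => intro a b; simp [mutSeqPair]
  | succ k ih =>
    intro a b
    have ih := ih (by omega)
    have hs := mutSeqPair_succ_aux (B, C) v ⟨k, hk⟩
    simp only at hs
    rw [hs]
    simp only [mutPair, mutB, Matrix.of_apply, hinj.eq_iff, ih]
    have hdiag : ∀ a, B (v a) (v a) = 0 := fun a => by have := hskew (v a) (v a); omega
    by_cases ha : a = ⟨k, hk⟩
    · subst ha
      by_cases hb : b = ⟨k, hk⟩
      · subst hb; simp [hdiag]
      · have : b.1 ≠ k := fun h => hb (Fin.ext h)
        have h1 : b.1 < k + 1 ↔ b.1 < k := by omega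
        simp only [h1]
        by_cases h : b.1 < k <;> simp [h]
    · have hak : a.1 ≠ k := fun h => ha (Fin.ext h)
      have h1 : a.1 < k + 1 ↔ a.1 < k := by omega
      by_cases hb : b = ⟨k, hk⟩
      · subst hb
        simp only [h1]
        by_cases h : a.1 < k <;> simp [h]
      · have hbk : b.1 ≠ k := fun h => hb (Fin.ext h)
        have h2 : b.1 < k + 1 ↔ b.1 < k := by omega
        simp only [h1, h2, ha, hb, or_self, if_false, lt_irrefl, iff_false, false_iff]
        have hA : (if ¬ a.1 < k then B (v a) (v ⟨k, hk⟩) else -B (v a) (v ⟨k, hk⟩)) ≤ 0 := by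
          by_cases h : a.1 < k <;> simp only [h, not_true, not_false_eq_true, if_true, if_false]
          · have := hord a ⟨k, hk⟩ (by rw [Fin.lt_def]; simp only; omega)
            omega
          · have := hord ⟨k, hk⟩ a (by rw [Fin.lt_def]; simp only; omega)
            have := hskew (v ⟨k, hk⟩) (v a)
            omega
        have hB : 0 ≤ (if ¬ b.1 < k then B (v ⟨k, hk⟩) (v b) else -B (v ⟨k, hk⟩) (v b)) := by
          by_cases h : b.1 < k <;> simp only [h, not_true, not_false_eq_true, if_true, if_false]
          · have := hord b ⟨k, hk⟩ (by rw [Fin.lt_def]; simp only; omega)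
            have := hskew (v b) (v ⟨k, hk⟩)
            omega
          · have := hord ⟨k, hk⟩ b (by rw [Fin.lt_def]; simp only; omega)
            omega
        rw [max_eq_right (mul_nonpos_of_nonpos_of_nonneg hA hB)]
        simp

/-- A source mutation at `v k` subtracts at least twice the negative part of `c_{v k}`. -/
theorem C_step_aux {n m : ℕ}
    (B : Matrix (Fin n) (Fin n) ℤ) (C : Matrix (Fin n) (Fin m) ℤ)
    (hskew : ∀ i j, B j i = -B i j) (habund : QAbundant B)
    (v : Fin n → Fin n) (hinj : Function.Injective v)
    (hord : ∀ i j : Fin n, i < j → 0 < B (v i) (v j)) (k a : Fin n) (hak : a ≠ k) (t : Fin m) :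
    (mutSeqPair (B, C) ((List.ofFn v).take (k.1 + 1))).2 (v a) t ≤
      (mutSeqPair (B, C) ((List.ofFn v).take k.1)).2 (v a) t +
        2 * min ((mutSeqPair (B, C) ((List.ofFn v).take k.1)).2 (v k) t) 0 := by
  have hb : (mutSeqPair (B, C) ((List.ofFn v).take k.1)).1 (v a) (v k) ≤ -2 := by
    rw [B_inv_aux B C hskew v hinj hord k.1 k.2.le]
    have h2 := habund (v a) (v k) (fun h => hak (hinj h))
    rcases lt_or_gt_of_ne hak with h | h
    · have h3 := hord a k h
      rw [abs_of_pos h3] at h2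
      rw [Fin.lt_def] at h
      simp only [h, lt_irrefl, iff_false, not_true, if_false]
      omega
    · have h3 := hord k a h
      have h4 := hskew (v k) (v a)
      rw [abs_of_neg (by omega)] at h2
      rw [Fin.lt_def] at h
      have h5 : ¬ a.1 < k.1 := by omega
      simp only [h5, lt_irrefl, if_true]
      omega
  rw [mutSeqPair_succ_aux]
  generalize mutSeqPair (B, C) ((List.ofFn v).take k.1) = P at *
  have hne : v a ≠ v k := fun h => hak (hinj h)
  simp only [mutPair, mutC, Matrix.of_apply, hne, if_false]
  rw [Int.sign_eq_neg_one_of_neg (by omega)]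
  rcases le_total 0 (P.2 (v k) t) with h | h
  · rw [min_eq_right h, max_eq_right (by nlinarith)]; omega
  · rw [min_eq_left h, max_eq_left (by nlinarith)]; nlinarith

theorem C_self_aux {n m : ℕ} (P : Matrix (Fin n) (Fin n) ℤ × Matrix (Fin n) (Fin m) ℤ)
    (v : Fin n → Fin n) (k : Fin n) (t : Fin m) :
    (mutSeqPair P ((List.ofFn v).take (k.1 + 1))).2 (v k) t =
      - (mutSeqPair P ((List.ofFn v).take k.1)).2 (v k) t := by
  rw [mutSeqPair_succ_aux]
  simp [mutPair, mutC]

theorem C_inv_aux {n m : ℕ}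
    (B : Matrix (Fin n) (Fin n) ℤ) (C : Matrix (Fin n) (Fin m) ℤ)
    (hskew : ∀ i j, B j i = -B i j) (habund : QAbundant B)
    (v : Fin n → Fin n) (hinj : Function.Injective v)
    (hord : ∀ i j : Fin n, i < j → 0 < B (v i) (v j)) (j : Fin n) (t : Fin m)
    (k : ℕ) (hk : k ≤ j.1) :
    (mutSeqPair (B, C) ((List.ofFn v).take k)).2 (v j) t ≤ C (v j) t ∧
    ∀ i : Fin n, i.1 < k → (mutSeqPair (B, C) ((List.ofFn v).take k)).2 (v j) t ≤
      C (v j) t - 2 * max ((mutSeqPair (B, C) ((List.ofFn v).take k)).2 (v i) t) 0 := by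
  induction k with
  | zero => simp [mutSeqPair]
  | succ k ih =>
    obtain ⟨ih1, ih2⟩ := ih (by omega)
    have hkn : k < n := by omega
    have hj := C_step_aux B C hskew habund v hinj hord ⟨k, hkn⟩ j
      (by intro h; rw [h] at hk; simp at hk) t
    simp only at hj
    refine ⟨by omega, fun i hi => ?_⟩
    by_cases hik : i = ⟨k, hkn⟩
    · subst hik
      have := C_self_aux (B, C) v ⟨k, hkn⟩ t
      simp only at this
      omega
    · have h1 : i.1 ≠ k := fun h => hik (Fin.ext h)
      have h2 := ih2 i (by omega)
      have h3 := C_step_aux B C hskew habund v hinj hord ⟨k, hkn⟩ i hik t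
      simp only at h3
      omega

/-- Lemma `lem-color-source-acyclic-mutation-order`. -/
theorem color_source_acyclic_mutation {n m : ℕ}
    (B : Matrix (Fin n) (Fin n) ℤ) (C : Matrix (Fin n) (Fin m) ℤ)
    (hskew : ∀ i j, B j i = -B i j)
    (husc : USC (B, C))
    (habund : QAbundant B) (hacyc : QAcyclic B)
    (v : Fin n → Fin n) (hsurj : Function.Surjective v)
    (hord : ∀ i j : Fin n, i < j → 0 < B (v i) (v j))
    (j : Fin n) (hred : QRed C (v j)) :
    (∀ i : Fin n, i < j →
      QRed (mutSeqPair (B, C) ((List.ofFn v).take (j.1 + 1))).2 (v i)) ∧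
    QGreen (mutSeqPair (B, C) ((List.ofFn v).take (j.1 + 1))).2 (v j) := by
  have hinj : Function.Injective v := Finite.injective_iff_surjective.mpr hsurj
  obtain ⟨hr, hne⟩ := hred
  obtain ⟨t, ht⟩ := Function.ne_iff.mp hne
  have ht : C (v j) t ≠ 0 := ht
  have htr := hr t
  have key := fun t => C_inv_aux B C hskew habund v hinj hord j t j.1 le_rfl
  constructor
  · intro i hi
    have hb : ∀ t, (mutSeqPair (B, C) ((List.ofFn v).take (j.1 + 1))).2 (v i) t
        ≤ 2 * C (v j) t := by
      intro t
      have h1 := C_step_aux B C hskew habund v hinj hord j i hi.ne t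
      have h2 := (key t).1
      have h3 := (key t).2 i hi
      have h4 := hr t
      omega
    refine ⟨fun t => by have := hb t; have := hr t; omega, fun h => ?_⟩
    have h1 := hb t
    rw [h] at h1
    simp only [Pi.zero_apply] at h1
    omega
  · refine ⟨fun t => ?_, fun h => ?_⟩
    · rw [C_self_aux]
      have := (key t).1
      have := hr t
      omega
    · have h1 := C_self_aux (B, C) v j t
      rw [h] at h1
      simp only [Pi.zero_apply] at h1
      have := (key t).1
      omega
end

section
/- Let Q = [B | C] be a uniformly sign-coherent ice quiver whose mutable subquiver is abundant acyclic with unique acyclic ordering v_1 ≺ v_2 ≺ ... ≺ v_n. If v_n is red in Q, then μ_{[v_1, v_2, ..., v_n]}(Q) has exactly n-1 red mutable vertices and one green mutable vertex, namely v_n. -/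
open Matrix

/-- Invariants along the mutation at the first `k` vertices `v 0, …, v (k-1)`. -/
theorem aux_invariant {n m : ℕ} (hn : 0 < n)
    (B : Matrix (Fin n) (Fin n) ℤ) (C : Matrix (Fin n) (Fin m) ℤ)
    (hskew : ∀ i j, B j i = -B i j)
    (v : Fin n → Fin n) (hinj : Function.Injective v)
    (hord : ∀ i j : Fin n, i < j → 0 < B (v i) (v j))
    (L : Fin n) (hL : L.val = n - 1) (hred : ∀ t, C (v L) t ≤ 0) (k : ℕ) (hk : k < n) :
    (∀ i j : Fin n, (mutSeqPair (B, C) ((List.ofFn v).take k)).1 (v i) (v j) =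
      if (i.val < k ↔ j.val < k) then B (v i) (v j) else -B (v i) (v j)) ∧
    (∀ t, (mutSeqPair (B, C) ((List.ofFn v).take k)).2 (v L) t ≤ C (v L) t) ∧
    (∀ (i : Fin n) t, i.val < k → (mutSeqPair (B, C) ((List.ofFn v).take k)).2 (v L) t ≤
      -(B (v i) (v L) * (mutSeqPair (B, C) ((List.ofFn v).take k)).2 (v i) t)) := by
  induction k with
  | zero => simp [mutSeqPair]
  | succ k ih =>
    obtain ⟨h1, h2, h3⟩ := ih (by omega)
    have hstep : mutSeqPair (B, C) ((List.ofFn v).take (k + 1)) =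
        mutPair (mutSeqPair (B, C) ((List.ofFn v).take k)) (v ⟨k, by omega⟩) := by
      rw [List.take_add_one]
      have : (List.ofFn v)[k]? = some (v ⟨k, by omega⟩) := by
        rw [List.getElem?_eq_getElem (by simp; omega)]
        simp
      rw [this]
      simp [mutSeqPair, List.foldl_append]
    rw [hstep]
    generalize mutSeqPair (B, C) ((List.ofFn v).take k) = P at h1 h2 h3
    obtain ⟨K, hK⟩ : ∃ K : Fin n, K = ⟨k, by omega⟩ := ⟨_, rfl⟩
    have hKv : K.val = k := by rw [hK]
    rw [← hK]
    have hself : ∀ i, B i i = 0 := fun i => by have := hskew i i; omega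
    -- `v K` is a source of the current quiver
    have hneg : ∀ i, i ≠ K → P.1 (v i) (v K) < 0 := by
      intro i hi
      rw [h1]
      rcases lt_or_gt_of_ne hi with h | h
      · have := hord i K h
        rw [if_neg (by omega)]; omega
      · have := hord K i h
        have h' := hskew (v K) (v i)
        rw [if_pos (by omega)]; omega
    have hpos : ∀ i, i ≠ K → 0 < P.1 (v K) (v i) := by
      intro i hi
      rw [h1]
      rcases lt_or_gt_of_ne hi with h | h
      · have := hord i K h
        have h' := hskew (v i) (v K)
        rw [if_neg (by omega)]; omega
      · have := hord K i h
        rw [if_pos (by omega)]; omega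
    have hCK : ∀ t, (mutPair P (v K)).2 (v K) t = -P.2 (v K) t := by
      intro t; simp [mutPair, mutC]
    have hC : ∀ i t, i ≠ K → (mutPair P (v K)).2 (v i) t =
        P.2 (v i) t - max (P.1 (v i) (v K) * P.2 (v K) t) 0 := by
      intro i t hi
      simp [mutPair, mutC, hinj.eq_iff, hi, Int.sign_eq_neg_one_of_neg (hneg i hi)]
      ring
    have hLK : L ≠ K := by intro h; rw [h] at hL; omega
    have hLle : ∀ t, (mutPair P (v K)).2 (v L) t ≤ P.2 (v L) t := by
      intro t; rw [hC L t hLK]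
      have := le_max_right (P.1 (v L) (v K) * P.2 (v K) t) 0
      omega
    refine ⟨?_, fun t => (hLle t).trans (h2 t), ?_⟩
    · intro i j
      by_cases hi : i = K
      · subst hi
        by_cases hj : j = i
        · subst hj; simp [mutPair, mutB, h1, hself]
        · have : j.val ≠ i.val := fun h => hj (Fin.ext h)
          simp only [mutPair, mutB, Matrix.of_apply, true_or, if_true, h1]
          by_cases hjk : j.val < k
          · rw [if_neg (by omega), if_pos (by omega)]; ring
          · rw [if_pos (by omega), if_neg (by omega)]
      · have hi' : i.val ≠ K.val := fun h => hi (Fin.ext h)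
        by_cases hj : j = K
        · subst hj
          simp only [mutPair, mutB, Matrix.of_apply, or_true, if_true, h1]
          by_cases hjk : i.val < k
          · rw [if_neg (by omega), if_pos (by omega)]; ring
          · rw [if_pos (by omega), if_neg (by omega)]
        · have hj' : j.val ≠ K.val := fun h => hj (Fin.ext h)
          have hm : max (P.1 (v i) (v K) * P.1 (v K) (v j)) 0 = 0 :=
            max_eq_right (mul_nonpos_of_nonpos_of_nonneg (hneg i hi).le (hpos j hj).le)
          have e1 : (mutPair P (v K)).1 (v i) (v j) = P.1 (v i) (v j) := by
            simp [mutPair, mutB, hinj.eq_iff, hi, hj, hm]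
          have e2 : (i.val < k + 1 ↔ j.val < k + 1) ↔ (i.val < k ↔ j.val < k) := by omega
          rw [e1, h1]
          simp only [e2]
    · intro i t hik
      by_cases hi : i = K
      · subst hi
        rw [hCK, hC L t hLK]
        have e : P.1 (v L) (v i) = -B (v i) (v L) := by
          rw [h1, if_pos (by omega)]; exact hskew _ _
        have := le_max_left (P.1 (v L) (v i) * P.2 (v i) t) 0
        rw [e] at this ⊢
        have := h2 t
        have := hred t
        linarith
      · have hi' : i.val ≠ K.val := fun h => hi (Fin.ext h)
        have a := h3 i t (by omega)
        have b := hLle t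
        have c := hC i t hi
        have d := le_max_right (P.1 (v i) (v K) * P.2 (v K) t) 0
        have e := hord i L (by rw [Fin.lt_def]; omega)
        have f : (mutPair P (v K)).2 (v i) t ≤ P.2 (v i) t := by omega
        nlinarith [mul_le_mul_of_nonneg_left f e.le]

/-- Corollary `cor-source-acyclic-almost-reddening`. -/
theorem source_acyclic_almost_reddening {n m : ℕ} (hn : 0 < n)
    (B : Matrix (Fin n) (Fin n) ℤ) (C : Matrix (Fin n) (Fin m) ℤ)
    (hskew : ∀ i j, B j i = -B i j)
    (husc : USC (B, C))
    (habund : QAbundant B) (hacyc : QAcyclic B)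
    (v : Fin n → Fin n) (hsurj : Function.Surjective v)
    (hord : ∀ i j : Fin n, i < j → 0 < B (v i) (v j))
    (hred : QRed C (v ⟨n - 1, by omega⟩)) :
    QGreen (mutSeqPair (B, C) (List.ofFn v)).2 (v ⟨n - 1, by omega⟩) ∧
    ∀ u : Fin n, u ≠ v ⟨n - 1, by omega⟩ →
      QRed (mutSeqPair (B, C) (List.ofFn v)).2 u := by
  have hinj : Function.Injective v := Finite.injective_iff_surjective.mpr hsurj
  obtain ⟨L, hLdef⟩ : ∃ L : Fin n, L = ⟨n - 1, by omega⟩ := ⟨_, rfl⟩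
  have hL : L.val = n - 1 := by rw [hLdef]
  rw [← hLdef] at hred ⊢
  obtain ⟨h1, h2, h3⟩ := aux_invariant hn B C hskew v hinj hord L hL hred.1 (n - 1) (by omega)
  have hstep : mutSeqPair (B, C) (List.ofFn v) =
      mutPair (mutSeqPair (B, C) ((List.ofFn v).take (n - 1))) (v L) := by
    have e : List.ofFn v = (List.ofFn v).take (n - 1) ++ [v L] := by
      conv_lhs => rw [← List.take_of_length_le (l := List.ofFn v) (i := n - 1 + 1) (by simp; omega)]
      rw [List.take_add_one]
      have : (List.ofFn v)[n - 1]? = some (v L) := by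
        rw [List.getElem?_eq_getElem (by simp; omega)]
        simp [hLdef]
      rw [this]; rfl
    conv_lhs => rw [e]
    simp [mutSeqPair, List.foldl_append]
  rw [hstep]
  generalize mutSeqPair (B, C) ((List.ofFn v).take (n - 1)) = P at h1 h2 h3
  obtain ⟨t₀, ht₀⟩ : ∃ t, C (v L) t ≠ 0 := by
    by_contra! h
    exact hred.2 (funext h)
  have hlt₀ : P.2 (v L) t₀ < 0 := lt_of_le_of_lt (h2 t₀) (lt_of_le_of_ne (hred.1 t₀) ht₀)
  have hle : ∀ t, P.2 (v L) t ≤ 0 := fun t => (h2 t).trans (hred.1 t)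
  have hCL : ∀ t, (mutPair P (v L)).2 (v L) t = -P.2 (v L) t := by
    intro t; simp [mutPair, mutC]
  constructor
  · refine ⟨fun t => by rw [hCL]; have := hle t; omega, fun h => ?_⟩
    have := congrFun h t₀
    rw [hCL] at this
    simp only [Pi.zero_apply] at this
    omega
  · intro u hu
    obtain ⟨i, rfl⟩ := hsurj u
    have hi : i ≠ L := fun h => hu (by rw [h])
    have hi' : i.val ≠ L.val := fun h => hi (Fin.ext h)
    have hb := hord i L (by rw [Fin.lt_def]; omega)
    have hb2 : 2 ≤ B (v i) (v L) := by
      have := habund (v i) (v L) hu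
      rwa [abs_of_pos hb] at this
    have e : P.1 (v i) (v L) = -B (v i) (v L) := by
      rw [h1, if_neg (by omega)]
    have hC : ∀ t, (mutPair P (v L)).2 (v i) t =
        P.2 (v i) t + B (v i) (v L) * P.2 (v L) t := by
      intro t
      have hm : max (-B (v i) (v L) * P.2 (v L) t) 0 = -B (v i) (v L) * P.2 (v L) t :=
        max_eq_left (by nlinarith [hle t])
      have hs : (-B (v i) (v L)).sign = -1 := Int.sign_eq_neg_one_of_neg (by omega)
      simp only [mutPair, mutC, Matrix.of_apply, if_neg hu, e, hm, hs]
      ring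
    have key : ∀ t, B (v i) (v L) * (mutPair P (v L)).2 (v i) t ≤ 3 * P.2 (v L) t := by
      intro t
      rw [hC]
      have a := h3 i t (by omega)
      have b4 : 4 ≤ B (v i) (v L) * B (v i) (v L) := by nlinarith
      nlinarith [mul_le_mul_of_nonpos_right b4 (hle t)]
    refine ⟨fun t => ?_, fun h => ?_⟩
    · have a := key t
      have b := hle t
      by_contra! hc
      nlinarith [mul_pos hb hc]
    · have a := key t₀
      rw [h] at a
      simp only [Pi.zero_apply, mul_zero] at a
      omega
end

section
/- Let Q = [B | C] be a uniformly sign-coherent ice quiver whose mutable subquiver is a fork with point of return r, and let v_1 ≺ ... ≺ v_{n-1} be the unique acyclic ordering of F \ {r}. For i ≤ n-1 set F^i = μ_{[v_1,...,v_i]}(Q), with F^0 = Q. Then for each j ≤ n-1: if r is green in Q, then r is green in F^j; if r is blue in Q, then r is blue in F^j if no vertex v_i is green in F^{i-1} for all i ≤ j, and otherwise r is green in F^j. Furthermore, if v_{n-1} is red in Q, then v_{n-1} is green in F^{n-1} and every other mutable vertex of F^{n-1} besides possibly r is red. -/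
open Matrix

lemma csf_chain_succ {α : Type*} (R : α → α → Prop) (z : α) :
    ∀ (l : List α) (x : α), List.Chain R x (l ++ [z]) → ∀ y ∈ x :: l, ∃ w, R y w := by
  intro l
  induction l with
  | nil =>
    intro x h y hy
    simp at hy
    subst hy
    have h2 : List.IsChain R (y :: ([] ++ [z])) := h
    simp at h2
    exact ⟨z, h2⟩
  | cons a l ih =>
    intro x h y hy
    have h2 : List.IsChain R (x :: a :: (l ++ [z])) := h
    rw [List.isChain_cons_cons] at h2
    rcases List.mem_cons.1 hy with rfl | hy
    · exact ⟨a, h2.1⟩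
    · exact ih a h2.2 y hy

lemma csf_out {n : ℕ} (B : Matrix (Fin n) (Fin n) ℤ) (r : Fin n) (hfork : QFork B r) :
    ∃ y, 0 < B r y := by
  by_contra hcon
  obtain ⟨-, h1, h2, -⟩ := hfork
  apply h1
  rintro ⟨x, l, -, -, hc⟩
  have key := csf_chain_succ _ _ l x hc
  have hne : ∀ y ∈ x :: l, y ≠ r := by
    rintro y hy rfl
    exact hcon (key y hy)
  exact h2 ⟨x, l, hne x (by simp), fun y hy => hne y (by simp [hy]), hc⟩

/-- Successive mutations. -/
def csfS {n m p : ℕ} (B : Matrix (Fin n) (Fin n) ℤ) (C : Matrix (Fin n) (Fin m) ℤ)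
    (v : Fin p → Fin n) (j : ℕ) : Matrix (Fin n) (Fin n) ℤ × Matrix (Fin n) (Fin m) ℤ :=
  mutSeqPair (B, C) ((List.ofFn v).take j)

section
variable {n m p : ℕ} (B : Matrix (Fin n) (Fin n) ℤ) (C : Matrix (Fin n) (Fin m) ℤ)
  (v : Fin p → Fin n)

lemma csfS_zero : csfS B C v 0 = (B, C) := by simp [csfS, mutSeqPair]

lemma csfS_succ (j : ℕ) (hj : j < p) :
    csfS B C v (j + 1) = mutPair (csfS B C v j) (v ⟨j, hj⟩) := by
  unfold csfS mutSeqPair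
  rw [List.take_add_one]
  simp [hj]

lemma csf_inj (hskew : ∀ i j, B j i = -B i j)
    (hord : ∀ i j : Fin p, i < j → 0 < B (v i) (v j)) : Function.Injective v := by
  have hd : ∀ x, B x x = 0 := fun x => by have := hskew x x; omega
  intro a b hab
  rcases lt_trichotomy a b with h | h | h
  · have := hord a b h
    rw [hab, hd] at this
    omega
  · exact h
  · have := hord b a h
    rw [hab, hd] at this
    omega

lemma csf_B (hskew : ∀ i j, B j i = -B i j)
    (hord : ∀ i j : Fin p, i < j → 0 < B (v i) (v j)) (j : ℕ) (hj : j ≤ p) :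
    ∀ a b : Fin p, (csfS B C v j).1 (v a) (v b) =
      if ((a : ℕ) < j ↔ (b : ℕ) < j) then B (v a) (v b) else - B (v a) (v b) := by
  have hinj := csf_inj B v hskew hord
  induction j with
  | zero => intro a b; simp [csfS_zero]
  | succ j ih =>
    have ih := ih (by omega)
    intro a b
    rw [csfS_succ B C v j (by omega)]
    simp only [mutPair, mutB, Matrix.of_apply, hinj.eq_iff]
    have h0 : ∀ x : Fin p, x ≠ ⟨j, by omega⟩ → 0 < (csfS B C v j).1 (v ⟨j, by omega⟩) (v x)
        ∧ (csfS B C v j).1 (v x) (v ⟨j, by omega⟩) < 0 := by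
      intro x hx
      rw [ih, ih]
      have hx' : (x : ℕ) ≠ j := fun h => hx (Fin.ext h)
      rcases lt_or_gt_of_ne hx' with h | h
      · have := hord x ⟨j, by omega⟩ h
        have h3 := hskew (v x) (v ⟨j, by omega⟩)
        simp [h]
        omega
      · have := hord ⟨j, by omega⟩ x h
        have h3 := hskew (v x) (v ⟨j, by omega⟩)
        simp [h.not_gt]
        omega
    by_cases ha : a = ⟨j, by omega⟩
    · by_cases hb : b = ⟨j, by omega⟩
      · subst ha; subst hb
        have := hskew (v ⟨j, by omega⟩) (v ⟨j, by omega⟩)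
        rw [ih]
        simp
        omega
      · have hb' : (b : ℕ) ≠ j := fun h => hb (Fin.ext h)
        rw [if_pos (Or.inl ha), ih]
        subst ha
        simp only
        split_ifs <;> omega
    · have ha' : (a : ℕ) ≠ j := fun h => ha (Fin.ext h)
      by_cases hb : b = ⟨j, by omega⟩
      · rw [if_pos (Or.inr hb), ih]
        subst hb
        simp only
        split_ifs <;> omega
      · have hb' : (b : ℕ) ≠ j := fun h => hb (Fin.ext h)
        rw [if_neg (by tauto)]
        have h1 := (h0 a ha).2
        have h2 := (h0 b hb).1
        rw [max_eq_right (mul_neg_of_neg_of_pos h1 h2).le, ih]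
        simp only [mul_zero, add_zero]
        split_ifs <;> omega

lemma csf_r (hskew : ∀ i j, B j i = -B i j)
    (r : Fin n) (hfork : QFork B r) (hner : ∀ i, v i ≠ r)
    (henum : ∀ u, u ≠ r → ∃ i, u = v i)
    (hord : ∀ i j : Fin p, i < j → 0 < B (v i) (v j)) (j : ℕ) (hj : j ≤ p) :
    ∀ i : Fin p, j ≤ i → (j = 0 → (i : ℕ) = 0) → 0 < (csfS B C v j).1 r (v i) := by
  have hinj := csf_inj B v hskew hord
  have hd : ∀ x, B x x = 0 := fun x => by have := hskew x x; omega
  have base : ∀ i : Fin p, (i : ℕ) = 0 → 0 < B r (v i) := by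
    intro i hi
    by_contra hcon
    obtain ⟨y, hy⟩ := csf_out B r hfork
    have hyr : y ≠ r := by rintro rfl; rw [hd] at hy; omega
    obtain ⟨k, rfl⟩ := henum y hyr
    have hab := hfork.1 r (v i) (hner i).symm
    have h1 : 0 < B (v i) r := by
      rw [hskew r (v i)]
      rcases abs_cases (B r (v i)) with h | h <;> omega
    have h2 := (hfork.2.2.2 (v i) (v k) h1 hy).1
    rcases eq_or_ne i k with h | h
    · subst h; omega
    · have h3 := hord i k (by
        rw [Fin.lt_def]
        have : (i : ℕ) ≠ k := fun h' => h (Fin.ext h')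
        omega)
      have h4 := hskew (v i) (v k)
      omega
  induction j with
  | zero => intro i _ h; rw [csfS_zero]; exact base i (h rfl)
  | succ j ih =>
    have ih := ih (by omega)
    intro i hi _
    have hji : (⟨j, by omega⟩ : Fin p) < i := by rw [Fin.lt_def]; simp; omega
    rw [csfS_succ B C v j (by omega)]
    simp only [mutPair, mutB, Matrix.of_apply, hinj.eq_iff]
    rw [if_neg (by rintro (h | h); exact hner _ h.symm; exact hji.ne' h)]
    have hpos := ih ⟨j, by omega⟩ (by simp) (by simp)
    rw [Int.sign_eq_one_of_pos hpos, one_mul]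
    rcases Nat.eq_zero_or_pos j with h0 | h0
    · subst h0
      rw [csfS_zero] at hpos ⊢
      simp only at hpos ⊢
      have h5 := hord _ _ hji
      have h6 := le_max_left (B r (v ⟨0, by omega⟩) * B (v ⟨0, by omega⟩) (v i)) 0
      have h8 := le_max_right (B r (v ⟨0, by omega⟩) * B (v ⟨0, by omega⟩) (v i)) 0
      have h7 : B (v ⟨0, by omega⟩) (v i) ≤
        B r (v ⟨0, by omega⟩) * B (v ⟨0, by omega⟩) (v i) := by nlinarith
      by_cases hc : 0 < B (v i) r
      · have h9 := (hfork.2.2.2 _ _ hc hpos).1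
        have := hskew r (v i)
        omega
      · have := hskew r (v i)
        omega
    · have := ih i (by omega) (by omega)
      have h8 := le_max_right ((csfS B C v j).1 r (v ⟨j, by omega⟩) *
        (csfS B C v j).1 (v ⟨j, by omega⟩) (v i)) 0
      omega

lemma csf_Cr (hskew : ∀ i j, B j i = -B i j)
    (r : Fin n) (hfork : QFork B r) (hner : ∀ i, v i ≠ r)
    (henum : ∀ u, u ≠ r → ∃ i, u = v i)
    (hord : ∀ i j : Fin p, i < j → 0 < B (v i) (v j)) (j : ℕ) (hj : j < p) :
    ∃ b : ℤ, 0 < b ∧ ∀ t, (csfS B C v (j + 1)).2 r t =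
      (csfS B C v j).2 r t + max (b * (csfS B C v j).2 (v ⟨j, hj⟩) t) 0 := by
  have hpos := csf_r B C v hskew r hfork hner henum hord j hj.le ⟨j, hj⟩ (by simp) (by simp)
  refine ⟨_, hpos, fun t => ?_⟩
  rw [csfS_succ B C v j hj]
  simp only [mutPair, mutC, Matrix.of_apply]
  rw [if_neg (fun h => hner _ h.symm), Int.sign_eq_one_of_pos hpos, one_mul]

lemma csf_Cv (hskew : ∀ i j, B j i = -B i j)
    (hord : ∀ i j : Fin p, i < j → 0 < B (v i) (v j)) (j : ℕ) (hj : j < p)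
    (a : Fin p) (ha : a ≠ ⟨j, hj⟩) (t : Fin m) :
    (csfS B C v (j + 1)).2 (v a) t =
      (csfS B C v j).2 (v a) t + min (|B (v a) (v ⟨j, hj⟩)| * (csfS B C v j).2 (v ⟨j, hj⟩) t) 0 := by
  have hinj := csf_inj B v hskew hord
  have ha' : (a : ℕ) ≠ j := fun h => ha (Fin.ext h)
  have hneg : (csfS B C v j).1 (v a) (v ⟨j, hj⟩) = - |B (v a) (v ⟨j, hj⟩)| ∧
      0 < |B (v a) (v ⟨j, hj⟩)| := by
    rw [csf_B B C v hskew hord j hj.le]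
    rcases lt_or_gt_of_ne ha' with h | h
    · have := hord a ⟨j, hj⟩ h
      simp [h, abs_of_pos this, this]
    · have := hord ⟨j, hj⟩ a h
      have h3 := hskew (v ⟨j, hj⟩) (v a)
      have h4 : B (v a) (v ⟨j, hj⟩) < 0 := by omega
      simp [h.not_gt, abs_of_neg h4, h4]
  rw [csfS_succ B C v j hj]
  simp only [mutPair, mutC, Matrix.of_apply, hinj.eq_iff]
  rw [if_neg ha, hneg.1, Int.sign_eq_neg_one_of_neg (by omega)]
  rw [neg_mul (|B (v a) (v ⟨j, hj⟩)|), neg_mul, one_mul]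
  rcases max_cases (-(|B (v a) (v ⟨j, hj⟩)| * (csfS B C v j).2 (v ⟨j, hj⟩) t)) 0 with h | h <;>
  rcases min_cases (|B (v a) (v ⟨j, hj⟩)| * (csfS B C v j).2 (v ⟨j, hj⟩) t) 0 with h' | h' <;> omega

lemma csf_Cself (j : ℕ) (hj : j < p) (t : Fin m) :
    (csfS B C v (j + 1)).2 (v ⟨j, hj⟩) t = - (csfS B C v j).2 (v ⟨j, hj⟩) t := by
  rw [csfS_succ B C v j hj]
  simp [mutPair, mutC]

lemma csf_inv (hskew : ∀ i j, B j i = -B i j) (husc : USC (B, C)) (habd : QAbundant B)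
    (hord : ∀ i j : Fin p, i < j → 0 < B (v i) (v j)) (L : Fin p)
    (j : ℕ) (hj : j ≤ L) :
    (∀ t, (csfS B C v j).2 (v L) t ≤ C (v L) t) ∧
    ∀ a : Fin p, (a : ℕ) < j → ∀ t, (csfS B C v j).2 (v a) t +
      |B (v a) (v L)| * (csfS B C v j).2 (v L) t ≤ |B (v a) (v L)| * C (v L) t := by
  have hinj := csf_inj B v hskew hord
  have hLp := L.2
  induction j with
  | zero => simp [csfS_zero]
  | succ j ih =>
    obtain ⟨ih1, ih2⟩ := ih (by omega)
    have hjp : j < p := by omega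
    have hLj : L ≠ ⟨j, hjp⟩ := by intro h; rw [h] at hj; simp at hj
    have hL := csf_Cv B C v hskew hord j hjp L hLj
    refine ⟨fun t => ?_, fun a ha t => ?_⟩
    · rw [hL]
      have := ih1 t
      have := min_le_right (|B (v L) (v ⟨j, hjp⟩)| * (csfS B C v j).2 (v ⟨j, hjp⟩) t) 0
      omega
    · have hab := abs_nonneg (B (v a) (v L))
      by_cases haj : a = ⟨j, hjp⟩
      · subst haj
        rw [csf_Cself, hL]
        have hb := habd (v ⟨j, hjp⟩) (v L) (fun h => hLj (hinj h).symm)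
        have hsym : |B (v L) (v ⟨j, hjp⟩)| = |B (v ⟨j, hjp⟩) (v L)| := by
          rw [hskew (v ⟨j, hjp⟩) (v L), abs_neg]
        rw [hsym]
        have h1 := ih1 t
        generalize |B (v ⟨j, hjp⟩) (v L)| = b at *
        have hs : 0 ≤ (csfS B C v j).2 (v ⟨j, hjp⟩) t ∨ (csfS B C v j).2 (v ⟨j, hjp⟩) t ≤ 0 := by
          omega
        rcases hs with hs | hs
        · rw [min_eq_right (by positivity)]
          nlinarith
        · rw [min_eq_left (by nlinarith)]
          have h2 : b * (csfS B C v j).2 (v L) t ≤ b * C (v L) t := by nlinarith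
          have h3 : 0 ≤ (b * b - 1) * (-(csfS B C v j).2 (v ⟨j, hjp⟩) t) :=
            mul_nonneg (by nlinarith) (by omega)
          nlinarith
      · have haj' : (a : ℕ) ≠ j := fun h => haj (Fin.ext h)
        rw [csf_Cv B C v hskew hord j hjp a haj, hL]
        have h1 := ih2 a (by omega) t
        have h2 := min_le_right (|B (v L) (v ⟨j, hjp⟩)| * (csfS B C v j).2 (v ⟨j, hjp⟩) t) 0
        have h3 := min_le_right (|B (v a) (v ⟨j, hjp⟩)| * (csfS B C v j).2 (v ⟨j, hjp⟩) t) 0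
        nlinarith [mul_nonneg hab (sub_nonneg.2 h2)]

end

/-- Corollary `cor-color-source-fork-mutation`. -/
theorem color_source_fork_mutation {n m : ℕ} (hn : 2 ≤ n)
    (B : Matrix (Fin n) (Fin n) ℤ) (C : Matrix (Fin n) (Fin m) ℤ)
    (hskew : ∀ i j, B j i = -B i j)
    (husc : USC (B, C))
    (r : Fin n) (hfork : QFork B r)
    (v : Fin (n - 1) → Fin n) (hner : ∀ i, v i ≠ r)
    (henum : ∀ u, u ≠ r → ∃ i, u = v i)
    (hord : ∀ i j : Fin (n - 1), i < j → 0 < B (v i) (v j)) :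
    (∀ j : ℕ, j ≤ n - 1 →
      (QGreen C r → QGreen (mutSeqPair (B, C) ((List.ofFn v).take j)).2 r) ∧
      (QBlue C r →
        ((∀ i : Fin (n - 1), (i : ℕ) < j →
            ¬ QGreen (mutSeqPair (B, C) ((List.ofFn v).take i.1)).2 (v i)) →
          QBlue (mutSeqPair (B, C) ((List.ofFn v).take j)).2 r) ∧
        ((∃ i : Fin (n - 1), (i : ℕ) < j ∧
            QGreen (mutSeqPair (B, C) ((List.ofFn v).take i.1)).2 (v i)) →
          QGreen (mutSeqPair (B, C) ((List.ofFn v).take j)).2 r))) ∧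
    (QRed C (v ⟨n - 2, by omega⟩) →
      QGreen (mutSeqPair (B, C) (List.ofFn v)).2 (v ⟨n - 2, by omega⟩) ∧
      ∀ u : Fin n, u ≠ r → u ≠ v ⟨n - 2, by omega⟩ →
        QRed (mutSeqPair (B, C) (List.ofFn v)).2 u) := by
  change (∀ j : ℕ, j ≤ n - 1 →
      (QGreen C r → QGreen (csfS B C v j).2 r) ∧
      (QBlue C r →
        ((∀ i : Fin (n - 1), (i : ℕ) < j → ¬ QGreen (csfS B C v i.1).2 (v i)) →
          QBlue (csfS B C v j).2 r) ∧
        ((∃ i : Fin (n - 1), (i : ℕ) < j ∧ QGreen (csfS B C v i.1).2 (v i)) →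
          QGreen (csfS B C v j).2 r))) ∧ _
  have hsc : ∀ j i, QRed (csfS B C v j).2 i ∨ QGreen (csfS B C v j).2 i ∨
    QBlue (csfS B C v j).2 i := fun j i => husc.1 _ i
  have hstep := csf_Cr B C v hskew r hfork hner henum hord
  have hgs : ∀ j, j < n - 1 → QGreen (csfS B C v j).2 r → QGreen (csfS B C v (j + 1)).2 r := by
    intro j hj hg
    obtain ⟨b, hb, h⟩ := hstep j hj
    have hle : ∀ t, (csfS B C v j).2 r t ≤ (csfS B C v (j + 1)).2 r t := by
      intro t
      rw [h t]
      have := le_max_right (b * (csfS B C v j).2 (v ⟨j, hj⟩) t) 0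
      omega
    refine ⟨fun t => (hg.1 t).trans (hle t), fun h0 => hg.2 ?_⟩
    funext t
    have h1 := hle t
    have h2 := hg.1 t
    have h3 := congrFun h0 t
    simp only [Pi.zero_apply] at h3 ⊢
    omega
  refine ⟨?_, ?_⟩
  · intro j
    induction j with
    | zero =>
      intro _
      simp [csfS_zero]
    | succ j ih =>
      intro hj
      have hj' : j < n - 1 := by omega
      obtain ⟨ih1, ih2⟩ := ih (by omega)
      refine ⟨fun hg => hgs j hj' (ih1 hg), fun hbl => ?_⟩
      obtain ⟨ih3, ih4⟩ := ih2 hbl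
      obtain ⟨b, hb, h⟩ := hstep j hj'
      refine ⟨fun hno => ?_, ?_⟩
      · have h0 := ih3 (fun i hi => hno i (by omega))
        have h1 : ∀ t, (csfS B C v j).2 (v ⟨j, hj'⟩) t ≤ 0 := by
          intro t
          rcases hsc j (v ⟨j, hj'⟩) with h2 | h2 | h2
          · exact h2.1 t
          · exact absurd h2 (hno ⟨j, hj'⟩ (by simp))
          · exact (congrFun h2 t).le
        funext t
        have h3 := congrFun h0 t
        rw [h t, h3, max_eq_right (by nlinarith [h1 t])]
        simp
      · rintro ⟨i, hi, hgi⟩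
        by_cases hprev : ∃ i : Fin (n - 1), (i : ℕ) < j ∧ QGreen (csfS B C v i.1).2 (v i)
        · exact hgs j hj' (ih4 hprev)
        · have h0 := ih3 (fun i hi hg => hprev ⟨i, hi, hg⟩)
          have hij : i = ⟨j, hj'⟩ := by
            apply Fin.ext
            have : ¬ (i : ℕ) < j := fun h => hprev ⟨i, h, hgi⟩
            simp
            omega
          subst hij
          have h4 : ∀ t, (csfS B C v (j + 1)).2 r t = b * (csfS B C v j).2 (v ⟨j, hj'⟩) t := by
            intro t
            have h3 := congrFun h0 t
            rw [h t, h3, max_eq_left (mul_nonneg hb.le (hgi.1 t))]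
            simp
          refine ⟨fun t => ?_, fun h5 => hgi.2 ?_⟩
          · rw [h4]
            exact mul_nonneg hb.le (hgi.1 t)
          · funext t
            have h6 := congrFun h5 t
            rw [h4] at h6
            simpa [hb.ne'] using h6
  · intro hred
    have hL : n - 2 < n - 1 := by omega
    have hfull : mutSeqPair (B, C) (List.ofFn v) = csfS B C v (n - 2 + 1) := by
      unfold csfS
      rw [List.take_of_length_le]
      simp
      omega
    rw [hfull]
    have hinj := csf_inj B v hskew hord
    obtain ⟨h1, h2⟩ := csf_inv B C v hskew husc hfork.1 hord ⟨n - 2, hL⟩ (n - 2) le_rfl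
    refine ⟨⟨fun t => ?_, fun h0 => hred.2 ?_⟩, ?_⟩
    · rw [csf_Cself]
      have := h1 t
      have := hred.1 t
      omega
    · funext t
      have h3 := congrFun h0 t
      rw [csf_Cself] at h3
      have := h1 t
      have := hred.1 t
      simp only [Pi.zero_apply] at h3 ⊢
      omega
    · intro u hur hul
      obtain ⟨a, rfl⟩ := henum u hur
      have ha : a ≠ ⟨n - 2, hL⟩ := fun h => hul (by rw [h])
      have ha' : (a : ℕ) ≠ n - 2 := fun h => ha (Fin.ext h)
      have hb := hfork.1 (v a) (v ⟨n - 2, hL⟩) hul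
      have hle : ∀ t, (csfS B C v (n - 2 + 1)).2 (v a) t ≤ 
          |B (v a) (v ⟨n - 2, hL⟩)| * C (v ⟨n - 2, hL⟩) t := by
        intro t
        rw [csf_Cv B C v hskew hord (n - 2) hL a ha]
        have h3 := h2 a (by omega) t
        have h4 := min_le_left (|B (v a) (v ⟨n - 2, hL⟩)| *
          (csfS B C v (n - 2)).2 (v ⟨n - 2, hL⟩) t) 0
        omega
      refine ⟨fun t => (hle t).trans (by nlinarith [hred.1 t]), fun h0 => hred.2 ?_⟩
      funext t
      have h3 := congrFun h0 t
      have h4 := hle t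
      have h5 := hred.1 t
      rw [h3] at h4
      simp only [Pi.zero_apply] at h4 ⊢
      nlinarith
end
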